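/- arXiv:2010.10765 — 2 statements merged into one kernel-verified Lean document; each statement's English description precedes it below -/
import Mathlib

section
/- Let Λ be a left and right noetherian ring, let m, n ∈ ℕ ∪ {∞}, and let M be a finitely generated right Λ-module. Then M is (m,n)-torsionfree if and only if there exists an exact sequence P_{m+1} → P_m → ⋯ → P₀ →∂ P_{-1} → ⋯ → P_{-n} of finitely generated projective right Λ-modules whose Λ-dual sequence is also exact and such that the image of ∂ is isomorphic to M. -/
/-!
Formalization of a statement from:
T. Araya and R. Takahashi, "On reducing homological dimensions over noetherian
rings" (arXiv:2010.10765).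
-/

open Function Filter CategoryTheory

universe u

/-- A resolution of `M` by finitely generated free `A`-modules:
`⋯ → A^{rank 2} → A^{rank 1} → A^{rank 0} → M → 0`. -/
structure FreeResolution (A : Type u) [Ring A] (M : Type u) [AddCommGroup M]
    [Module A M] where
  rank : ℕ → ℕ
  d : ∀ i : ℕ, ((Fin (rank (i + 1)) → A) →ₗ[A] (Fin (rank i) → A))
  aug : (Fin (rank 0) → A) →ₗ[A] M
  aug_surjective : Function.Surjective aug
  exact_aug : Function.Exact (d 0) aug
  exact : ∀ i : ℕ, Function.Exact (d (i + 1)) (d i)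

/-- `ExtVanish A M N j` says that `Ext_A^{j+1}(M, N) = 0`: for every resolution `F`
of `M` by finitely generated free modules, the complex `Hom_A(F, N)` is exact at
homological position `j + 1`. -/
def ExtVanish (A : Type u) [Ring A] (M : Type u) [AddCommGroup M] [Module A M]
    (N : Type u) [AddCommGroup N] [Module A N] (j : ℕ) : Prop :=
  ∀ F : FreeResolution A M,
    Function.Exact
      (fun φ : (Fin (F.rank j) → A) →ₗ[A] N => φ.comp (F.d j))
      (fun φ : (Fin (F.rank (j + 1)) → A) →ₗ[A] N => φ.comp (F.d (j + 1)))

/-- `extNonzero A M N i` says that `Ext_A^i(M, N) ≠ 0`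
(for `i = 0` this reads `Hom_A(M, N) ≠ 0`). -/
def extNonzero (A : Type u) [Ring A] (M : Type u) [AddCommGroup M] [Module A M]
    (N : Type u) [AddCommGroup N] [Module A N] : ℕ → Prop
  | 0 => ∃ φ : M →ₗ[A] N, φ ≠ 0
  | (j + 1) => ¬ ExtVanish A M N j

/-- The `A`-dual `Hom_A(-, A)`, as an `Aᵐᵒᵖ`-linear map between dual modules. -/
def dualMap {A : Type u} [Ring A] {M N : Type u} [AddCommGroup M] [Module A M]
    [AddCommGroup N] [Module A N] (f : M →ₗ[A] N) :
    (N →ₗ[A] A) →ₗ[Aᵐᵒᵖ] (M →ₗ[A] A) where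
  toFun φ := φ.comp f
  map_add' _ _ := rfl
  map_smul' _ _ := rfl

/-- The (Auslander) transpose of `M` computed from the finite free presentation
`A^{rank 1} → A^{rank 0} → M → 0` contained in the resolution `F`, that is, the
cokernel of `Hom_A(A^{rank 0}, A) → Hom_A(A^{rank 1}, A)`; it is an `Aᵐᵒᵖ`-module
(i.e. a module on the other side), well defined up to projective summands. -/
abbrev FreeResolution.transpose {A : Type u} [Ring A] {M : Type u} [AddCommGroup M]
    [Module A M] (F : FreeResolution A M) : Type u :=
  ((Fin (F.rank 1) → A) →ₗ[A] A) ⧸ LinearMap.range (dualMap (F.d 0))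

/-- `M` is `(m,n)`-torsionfree: `Ext_A^i(M, A) = 0` for all `1 ≤ i ≤ m` and
`Ext_{Aᵒᵖ}^j(tr M, A) = 0` for all `1 ≤ j ≤ n` (read as "for all `i ≥ 1`", resp.
"for all `j ≥ 1`", when `m = ∞`, resp. `n = ∞`). -/
def IsMNTorsionFree (A : Type u) [Ring A] (M : Type u) [AddCommGroup M] [Module A M]
    (m n : ℕ∞) : Prop :=
  (∀ j : ℕ, (j : ℕ∞) + 1 ≤ m → ExtVanish A M A j) ∧
  (∀ F : FreeResolution A M, ∀ j : ℕ, (j : ℕ∞) + 1 ≤ n →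
    ExtVanish Aᵐᵒᵖ F.transpose A j)

/-- `M` is totally reflexive (= Gorenstein projective), i.e. `(∞,∞)`-torsionfree:
`Ext_A^i(M, A) = 0 = Ext_{Aᵒᵖ}^i(tr M, A)` for all `i ≥ 1`. -/
def IsTotallyReflexive (A : Type u) [Ring A] (M : Type u) [AddCommGroup M]
    [Module A M] : Prop :=
  IsMNTorsionFree A M ⊤ ⊤

/-- A `ℤ`-indexed sequence of `A`-modules `⋯ → P_{i+1} → P_i → P_{i-1} → ⋯`. -/
structure ZSeq (A : Type u) [Ring A] where
  P : ℤ → Type u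
  [acg : ∀ i, AddCommGroup (P i)]
  [mod : ∀ i, Module A (P i)]
  d : ∀ i : ℤ, P (i + 1) →ₗ[A] P i

attribute [instance] ZSeq.acg ZSeq.mod

/-- For `m, n ∈ ℕ ∪ {∞}`, the position `i : ℤ` lies in the range `-n ≤ i ≤ m + 1`
of the indices of the modules of a sequence `P_{m+1} → ⋯ → P_0 → P_{-1} → ⋯ → P_{-n}`. -/
def posIn (m n : ℕ∞) (i : ℤ) : Prop :=
  (0 ≤ i → (i.toNat : ℕ∞) ≤ m + 1) ∧ (i < 0 → ((-i).toNat : ℕ∞) ≤ n)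

/-- For `m, n ∈ ℕ ∪ {∞}`, the position `i : ℤ` lies in the range `-n + 1 ≤ i ≤ m`
of the interior nodes of a sequence `P_{m+1} → ⋯ → P_0 → P_{-1} → ⋯ → P_{-n}`
(the nodes at which exactness of the sequence makes sense). -/
def nodeIn (m n : ℕ∞) (i : ℤ) : Prop :=
  (0 < i → (i.toNat : ℕ∞) ≤ m) ∧ (i ≤ 0 → ((1 - i).toNat : ℕ∞) ≤ n)

section ExtCriterion

open CategoryTheory.Abelian

variable {R : Type u} [Ring R] {M N : Type u} [AddCommGroup M] [Module R M]
  [AddCommGroup N] [Module R N]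

/-- Dimension shifting along a surjection from a projective module. -/
lemma subsingleton_ext_succ_succ_iff {Q : Type u} [AddCommGroup Q] [Module R Q]
    [Module.Projective R Q] (p : Q →ₗ[R] M) (hp : Function.Surjective p) (j : ℕ) :
    Subsingleton (Ext (ModuleCat.of R M) (ModuleCat.of R N) (j + 1 + 1)) ↔
      Subsingleton (Ext (ModuleCat.of R (LinearMap.ker p)) (ModuleCat.of R N) (j + 1)) := by
  have hS := LinearMap.shortExact_shortComplexKer hp
  have : Projective p.shortComplexKer.X₂ :=
    inferInstanceAs (Projective (ModuleCat.of R Q))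
  constructor
  · intro h
    refine subsingleton_of_forall_eq 0 fun x ↦ ?_
    obtain ⟨y, hy⟩ := Ext.contravariant_sequence_exact₁ hS (ModuleCat.of R N) x
      (add_comm 1 (j + 1)) (h.elim _ _)
    rw [← hy, Ext.eq_zero_of_projective y, Ext.comp_zero]
  · intro h
    refine subsingleton_of_forall_eq 0 fun x ↦ ?_
    obtain ⟨y, hy⟩ := precomp_extClass_surjective_of_projective_X₂
      (ModuleCat.of R N) hS (j + 1) x
    rw [← hy, h.elim y 0, map_zero]

/-- `Ext¹(M, N)` vanishes iff every map to `N` from the kernel of a surjection `p : Q → M`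
with `Q` projective extends to `Q`. -/
lemma subsingleton_ext_one_iff {Q : Type u} [AddCommGroup Q] [Module R Q]
    [Module.Projective R Q] (p : Q →ₗ[R] M) (hp : Function.Surjective p) :
    Subsingleton (Ext (ModuleCat.of R M) (ModuleCat.of R N) (0 + 1)) ↔
      ∀ f : LinearMap.ker p →ₗ[R] N, ∃ g : Q →ₗ[R] N, g ∘ₗ (LinearMap.ker p).subtype = f := by
  have hS := LinearMap.shortExact_shortComplexKer hp
  have : Projective p.shortComplexKer.X₂ :=
    inferInstanceAs (Projective (ModuleCat.of R Q))
  constructor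
  · intro h f
    obtain ⟨y, hy⟩ := Ext.contravariant_sequence_exact₁ hS (ModuleCat.of R N)
      (Ext.mk₀ (ModuleCat.ofHom f)) (add_comm 1 0) (h.elim _ _)
    obtain ⟨g, rfl⟩ := (Ext.mk₀_bijective _ _).2 y
    rw [Ext.mk₀_comp_mk₀] at hy
    exact ⟨g.hom, congrArg ModuleCat.Hom.hom ((Ext.mk₀_bijective _ _).1 hy)⟩
  · intro h
    refine subsingleton_of_forall_eq 0 fun x ↦ ?_
    obtain ⟨y, rfl⟩ := precomp_extClass_surjective_of_projective_X₂
      (ModuleCat.of R N) hS 0 x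
    obtain ⟨f, rfl⟩ := (Ext.mk₀_bijective _ _).2 y
    obtain ⟨g, hg⟩ := h f.hom
    have hf : f = p.shortComplexKer.f ≫ ModuleCat.ofHom g := ModuleCat.hom_ext hg.symm
    change hS.extClass.comp (Ext.mk₀ f) (add_comm 1 0) = 0
    rw [hf, ← Ext.mk₀_comp_mk₀]
    exact hS.extClass_comp_assoc _

/-- For an exact sequence `X → Y → Z → W`, the sequence `Hom(Z, N) → Hom(Y, N) → Hom(X, N)` is
exact iff every map from the kernel of `Z → W` to `N` extends to `Z`. -/
lemma exact_comp_iff_extends {X Y Z W : Type u} [AddCommGroup X] [Module R X]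
    [AddCommGroup Y] [Module R Y] [AddCommGroup Z] [Module R Z] [AddCommGroup W] [Module R W]
    {f : X →ₗ[R] Y} {g : Y →ₗ[R] Z} {h : Z →ₗ[R] W} (hfg : Function.Exact f g)
    (hgh : Function.Exact g h) :
    Function.Exact (fun φ : Z →ₗ[R] N ↦ φ.comp g) (fun φ : Y →ₗ[R] N ↦ φ.comp f) ↔
      ∀ φ : LinearMap.ker h →ₗ[R] N, ∃ ψ : Z →ₗ[R] N,
        ψ ∘ₗ (LinearMap.ker h).subtype = φ := by
  let g' : Y →ₗ[R] LinearMap.ker h := g.codRestrict _ fun y ↦ (hgh _).2 ⟨y, rfl⟩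
  have hg' : Function.Surjective g' := by
    rintro ⟨z, hz⟩
    obtain ⟨y, rfl⟩ := (hgh z).1 hz
    exact ⟨y, rfl⟩
  have hfg' : Function.Exact f g' := fun y ↦ by
    rw [← hfg y, ← Submodule.coe_eq_zero]
    rfl
  constructor
  · intro H φ
    obtain ⟨ψ, hψ⟩ := (H (φ ∘ₗ g')).1 (by
      ext x
      simp [hfg'.apply_apply_eq_zero])
    refine ⟨ψ, ?_⟩
    rw [← LinearMap.cancel_right hg']
    exact hψ
  · intro H φ
    constructor
    · intro hφ
      obtain ⟨ψ, hψ⟩ := H ((LinearMap.ker g').liftQ φ (by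
        rw [LinearMap.exact_iff.1 hfg', LinearMap.range_le_ker_iff]
        exact hφ) ∘ₗ (g'.quotKerEquivOfSurjective hg').symm.toLinearMap)
      refine ⟨ψ, ?_⟩
      ext y
      have := LinearMap.congr_fun hψ (g' y)
      simp only [LinearMap.comp_apply] at this ⊢
      refine this.trans ?_
      have hy : (g'.quotKerEquivOfSurjective hg').symm (g' y) = Submodule.Quotient.mk y := by
        rw [LinearEquiv.symm_apply_eq]
        rfl
      erw [hy]
      simp
    · rintro ⟨ψ, rfl⟩
      ext x
      simp [hfg.apply_apply_eq_zero]

/-- `Ext^{j+1}(M, N)` vanishes iff `Hom(Q, N)` is exact in degree `j + 1`, for a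
sequence `Q` over `M` that is a projective resolution in the relevant degrees. -/
lemma subsingleton_ext_iff_exact (j : ℕ) (M : Type u) [AddCommGroup M] [Module R M]
    (Q : ℕ → Type u) [∀ i, AddCommGroup (Q i)] [∀ i, Module R (Q i)]
    (d : ∀ i, Q (i + 1) →ₗ[R] Q i) (p : Q 0 →ₗ[R] M)
    (hQ : ∀ i ≤ j, Module.Projective R (Q i)) (hp : Function.Surjective p)
    (hdp : Function.Exact (d 0) p)
    (hd : ∀ i ≤ j, Function.Exact (d (i + 1)) (d i)) :
    Subsingleton (Ext (ModuleCat.of R M) (ModuleCat.of R N) (j + 1)) ↔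
      Function.Exact (fun φ : Q j →ₗ[R] N ↦ φ.comp (d j))
        (fun φ : Q (j + 1) →ₗ[R] N ↦ φ.comp (d (j + 1))) := by
  have := hQ 0 (Nat.zero_le _)
  induction j generalizing M Q with
  | zero =>
    rw [subsingleton_ext_one_iff p hp, exact_comp_iff_extends (hd 0 le_rfl) hdp]
  | succ j ih =>
    rw [subsingleton_ext_succ_succ_iff p hp]
    let p' : Q 1 →ₗ[R] LinearMap.ker p := (d 0).codRestrict _ fun y ↦ (hdp _).2 ⟨y, rfl⟩
    refine ih (LinearMap.ker p) (fun i ↦ Q (i + 1)) (fun i ↦ d (i + 1)) p'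
      (fun i hi ↦ hQ (i + 1) (by lia)) ?_ ?_ (fun i hi ↦ hd (i + 1) (by lia)) (hQ 1 (by lia))
    · rintro ⟨z, hz⟩
      obtain ⟨y, rfl⟩ := (hdp z).1 hz
      exact ⟨y, rfl⟩
    · intro y
      rw [← hd 0 (by lia) y, ← Submodule.coe_eq_zero]
      rfl

/-- If the identity of `X` is the sum of a map through `Y` and a map through a projective
module, then the vanishing of a positive Ext passes from `Y` to `X`. -/
lemma subsingleton_ext_of_id_eq_add {X Y Q : Type u} [AddCommGroup X] [Module R X]
    [AddCommGroup Y] [Module R Y] [AddCommGroup Q] [Module R Q] [Module.Projective R Q]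
    (a : X →ₗ[R] Y) (b : Y →ₗ[R] X) (c : X →ₗ[R] Q) (e : Q →ₗ[R] X)
    (h : b ∘ₗ a + e ∘ₗ c = LinearMap.id) (j : ℕ)
    (hY : Subsingleton (Ext (ModuleCat.of R Y) (ModuleCat.of R N) (j + 1))) :
    Subsingleton (Ext (ModuleCat.of R X) (ModuleCat.of R N) (j + 1)) := by
  refine subsingleton_of_forall_eq 0 fun x ↦ ?_
  have hid : 𝟙 (ModuleCat.of R X) = ModuleCat.ofHom a ≫ ModuleCat.ofHom b +
      ModuleCat.ofHom c ≫ ModuleCat.ofHom e := ModuleCat.hom_ext h.symm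
  rw [← Ext.mk₀_id_comp x, hid, Ext.mk₀_add, Ext.add_comp, ← Ext.mk₀_comp_mk₀_assoc,
    ← Ext.mk₀_comp_mk₀_assoc, hY.elim (Ext.comp (Ext.mk₀ (ModuleCat.ofHom b)) x _) 0,
    Ext.eq_zero_of_projective (Ext.comp (Ext.mk₀ (ModuleCat.ofHom e)) x _), Ext.comp_zero,
    Ext.comp_zero, add_zero]

end ExtCriterion

section FreeResolutionExistence

variable (R : Type u) [Ring R] (M : Type u) [AddCommGroup M] [Module R M]

/-- A finitely generated module over a noetherian ring has a resolution by finitely generated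
free modules. -/
lemma nonempty_freeResolution [IsNoetherianRing R] [Module.Finite R M] :
    Nonempty (FreeResolution R M) := by
  have cover : ∀ X : Σ r : ℕ, Submodule R (Fin r → R),
      ∃ (s : ℕ) (f : (Fin s → R) →ₗ[R] (Fin X.1 → R)), LinearMap.range f = X.2 := by
    rintro ⟨r, K⟩
    obtain ⟨s, f, hf⟩ := Module.Finite.exists_fin' R K
    exact ⟨s, K.subtype ∘ₗ f, by
      rw [LinearMap.range_comp, LinearMap.range_eq_top.2 hf, Submodule.map_top,
        Submodule.range_subtype]⟩
  choose s f hf using cover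
  obtain ⟨r, aug, haug⟩ := Module.Finite.exists_fin' R M
  let syz : ℕ → Σ r : ℕ, Submodule R (Fin r → R) := fun i ↦
    Nat.rec ⟨r, LinearMap.ker aug⟩ (fun _ X ↦ ⟨s X, LinearMap.ker (f X)⟩) i
  exact ⟨{
    rank := fun i ↦ (syz i).1
    d := fun i ↦ f (syz i)
    aug := aug
    aug_surjective := haug
    exact_aug := LinearMap.exact_iff.2 (hf (syz 0)).symm
    exact := fun i ↦ LinearMap.exact_iff.2 (hf (syz (i + 1))).symm }⟩

variable {R M}

lemma FreeResolution.subsingleton_ext_iff (F : FreeResolution R M) (N : Type u)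
    [AddCommGroup N] [Module R N] (j : ℕ) :
    Subsingleton (Abelian.Ext (ModuleCat.of R M) (ModuleCat.of R N) (j + 1)) ↔
      Function.Exact
        (fun φ : (Fin (F.rank j) → R) →ₗ[R] N => φ.comp (F.d j))
        (fun φ : (Fin (F.rank (j + 1)) → R) →ₗ[R] N => φ.comp (F.d (j + 1))) :=
  subsingleton_ext_iff_exact j M (fun i ↦ Fin (F.rank i) → R) F.d F.aug
    (fun _ _ ↦ inferInstance) F.aug_surjective F.exact_aug fun i _ ↦ F.exact i

lemma extVanish_iff_subsingleton_ext [IsNoetherianRing R] [Module.Finite R M] (N : Type u)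
    [AddCommGroup N] [Module R N] (j : ℕ) :
    ExtVanish R M N j ↔
      Subsingleton (Abelian.Ext (ModuleCat.of R M) (ModuleCat.of R N) (j + 1)) := by
  obtain ⟨F⟩ := nonempty_freeResolution R M
  exact ⟨fun h ↦ (F.subsingleton_ext_iff N j).2 (h F),
    fun h F' ↦ (F'.subsingleton_ext_iff N j).1 h⟩

end FreeResolutionExistence

section BimoduleDual

variable {R S T X Y Z : Type u} [Ring R] [Ring S] [AddCommGroup T] [Module R T] [Module S T]
  [SMulCommClass R S T] [SMulCommClass S R T]
  [AddCommGroup X] [Module R X] [AddCommGroup Y] [Module R Y] [AddCommGroup Z] [Module R Z]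

variable (R S T X) in
/-- The evaluation map of a module into its double dual with respect to a bimodule. -/
def evalBidual : X →ₗ[R] ((X →ₗ[R] T) →ₗ[S] T) where
  toFun x :=
    { toFun := fun φ ↦ φ x
      map_add' := fun _ _ ↦ rfl
      map_smul' := fun _ _ ↦ rfl }
  map_add' x y := by ext φ; exact map_add φ x y
  map_smul' r x := by ext φ; exact map_smul φ r x

@[simp]
lemma evalBidual_apply_apply (x : X) (φ : X →ₗ[R] T) : evalBidual R S T X x φ = φ x := rfl

variable (R X) in
/-- Existence of a finite dual basis. -/
lemma exists_dual_basis [Module.Finite R X] [Module.Projective R X] :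
    ∃ (k : ℕ) (e : Fin k → X) (c : Fin k → (X →ₗ[R] R)), ∀ x, ∑ i, c i x • e i = x := by
  obtain ⟨k, f, g, -, -, hfg⟩ := Module.Finite.exists_comp_eq_id_of_projective R X
  refine ⟨k, fun i ↦ f (Pi.single i 1), fun i ↦ LinearMap.proj i ∘ₗ g, fun x ↦ ?_⟩
  conv_rhs => rw [← LinearMap.id_apply (R := R) x, ← hfg, LinearMap.comp_apply,
    pi_eq_sum_univ' (g x), map_sum]
  simp

variable (S) in
lemma finite_and_projective_dual [Module.Finite R X] [Module.Projective R X]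
    [Module.Finite S T] [Module.Projective S T] :
    Module.Finite S (X →ₗ[R] T) ∧ Module.Projective S (X →ₗ[R] T) := by
  obtain ⟨k, e, c, hec⟩ := exists_dual_basis R X
  have : Module.Projective S (Fin k → T) :=
    Module.Projective.of_equiv
      (DFinsupp.linearEquivFunOnFintype (R := S) (M := fun _ : Fin k ↦ T))
  let r : (Fin k → T) →ₗ[S] (X →ₗ[R] T) :=
    { toFun := fun t ↦ ∑ i, (LinearMap.toSpanSingleton R T (t i)) ∘ₗ c i
      map_add' := fun s t ↦ by
        ext x
        simp [Finset.sum_add_distrib]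
      map_smul' := fun a t ↦ by
        ext x
        simp [Finset.smul_sum, smul_comm a] }
  let s : (X →ₗ[R] T) →ₗ[S] (Fin k → T) :=
    LinearMap.pi fun i ↦ evalBidual R S T X (e i)
  have hrs : r ∘ₗ s = LinearMap.id := by
    ext φ x
    conv_rhs => rw [LinearMap.id_apply, ← hec x, map_sum]
    simp [r, s]
  exact ⟨Module.Finite.of_surjective r fun φ ↦ ⟨s φ, LinearMap.congr_fun hrs φ⟩,
    Module.Projective.of_split s r hrs⟩

lemma bijective_evalBidual [Module.Finite R X] [Module.Projective R X]
    (hinj : ∀ r : R, (∀ t : T, r • t = 0) → r = 0)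
    (hsurj : ∀ θ : T →ₗ[S] T, ∃ r : R, ∀ t, θ t = r • t) :
    Function.Bijective (evalBidual R S T X) := by
  obtain ⟨k, e, c, hec⟩ := exists_dual_basis R X
  constructor
  · rw [injective_iff_map_eq_zero]
    intro x hx
    rw [← hec x]
    refine Finset.sum_eq_zero fun i _ ↦ ?_
    rw [hinj (c i x) fun t ↦ LinearMap.congr_fun hx (LinearMap.toSpanSingleton R T t ∘ₗ c i),
      zero_smul]
  · intro θ
    let θ' : Fin k → T →ₗ[S] T := fun i ↦ θ ∘ₗ
      { toFun := fun t ↦ LinearMap.toSpanSingleton R T t ∘ₗ c i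
        map_add' := fun s t ↦ by ext x; simp
        map_smul' := fun a t ↦ by ext x; simp [smul_comm a] }
    choose r hr using fun i ↦ hsurj (θ' i)
    refine ⟨∑ i, r i • e i, ?_⟩
    ext φ
    have hφ : φ = ∑ i, LinearMap.toSpanSingleton R T (φ (e i)) ∘ₗ c i := by
      ext x
      conv_lhs => rw [← hec x, map_sum]
      simp
    rw [evalBidual_apply_apply, map_sum]
    conv_rhs => rw [hφ, map_sum]
    refine Finset.sum_congr rfl fun i _ ↦ ?_
    rw [map_smul, ← hr i]
    rfl

variable (S T) in
lemma exact_bidual_iff {f : X →ₗ[R] Y} {g : Y →ₗ[R] Z}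
    (hX : Function.Bijective (evalBidual R S T X)) (hY : Function.Bijective (evalBidual R S T Y))
    (hZ : Function.Bijective (evalBidual R S T Z)) :
    Function.Exact
        (fun θ : (X →ₗ[R] T) →ₗ[S] T ↦ θ.comp (LinearMap.lcomp S T f))
        (fun θ : (Y →ₗ[R] T) →ₗ[S] T ↦ θ.comp (LinearMap.lcomp S T g)) ↔
      Function.Exact f g := by
  constructor
  · intro H y
    rw [← (injective_iff_map_eq_zero' _).1 hZ.1]
    refine (H (evalBidual R S T Y y)).trans ⟨?_, ?_⟩
    · rintro ⟨θ, hθ⟩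
      obtain ⟨x, rfl⟩ := hX.2 θ
      exact ⟨x, hY.1 hθ⟩
    · rintro ⟨x, rfl⟩
      exact ⟨evalBidual R S T X x, rfl⟩
  · intro H θ
    obtain ⟨y, rfl⟩ := hY.2 θ
    change evalBidual R S T Z (g y) = 0 ↔ _
    rw [(injective_iff_map_eq_zero' _).1 hZ.1, H y]
    constructor
    · rintro ⟨x, rfl⟩
      exact ⟨evalBidual R S T X x, rfl⟩
    · rintro ⟨θ, hθ⟩
      obtain ⟨x, rfl⟩ := hX.2 θ
      exact ⟨x, hY.1 hθ⟩

end BimoduleDual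

section RingDual

variable (A : Type u) [Ring A] (X : Type u) [AddCommGroup X]

lemma bijective_evalBidual_self [Module A X] [Module.Finite A X] [Module.Projective A X] :
    Function.Bijective (evalBidual A Aᵐᵒᵖ A X) :=
  bijective_evalBidual (fun r hr ↦ by simpa using hr 1) fun θ ↦
    ⟨θ 1, fun t ↦ by simpa using map_smul θ (MulOpposite.op t) 1⟩

lemma bijective_evalBidual_op [Module Aᵐᵒᵖ X] [Module.Finite Aᵐᵒᵖ X]
    [Module.Projective Aᵐᵒᵖ X] :
    Function.Bijective (evalBidual Aᵐᵒᵖ A A X) :=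
  bijective_evalBidual (fun r hr ↦ by simpa using hr 1) fun θ ↦
    ⟨MulOpposite.op (θ 1), fun t ↦ by simpa using map_smul θ t 1⟩

instance finite_mulOpposite_self : Module.Finite Aᵐᵒᵖ A :=
  Module.Finite.equiv (MulOpposite.opLinearEquiv Aᵐᵒᵖ).symm

instance projective_mulOpposite_self : Module.Projective Aᵐᵒᵖ A :=
  Module.Projective.of_equiv (MulOpposite.opLinearEquiv Aᵐᵒᵖ).symm

instance finite_dual [Module A X] [Module.Finite A X] [Module.Projective A X] :
    Module.Finite Aᵐᵒᵖ (X →ₗ[A] A) :=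
  (finite_and_projective_dual Aᵐᵒᵖ).1

instance projective_dual [Module A X] [Module.Finite A X] [Module.Projective A X] :
    Module.Projective Aᵐᵒᵖ (X →ₗ[A] A) :=
  (finite_and_projective_dual Aᵐᵒᵖ).2

end RingDual

section Transpose

variable {A : Type u} [Ring A]

/-- The cokernel of the dual of a map; for a projective presentation it is the transpose. -/
abbrev dualCoker {X Y : Type u} [AddCommGroup X] [Module A X] [AddCommGroup Y] [Module A Y]
    (f : X →ₗ[A] Y) : Type u :=
  (X →ₗ[A] A) ⧸ LinearMap.range (dualMap f)

/-- Vanishing of a positive `Ext` of the transpose does not depend on the presentation. -/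
lemma subsingleton_ext_dualCoker {M X₀ X₁ Y₀ Y₁ N : Type u} [AddCommGroup M] [Module A M]
    [AddCommGroup X₀] [Module A X₀] [AddCommGroup X₁] [Module A X₁]
    [AddCommGroup Y₀] [Module A Y₀] [AddCommGroup Y₁] [Module A Y₁]
    [AddCommGroup N] [Module Aᵐᵒᵖ N]
    [Module.Projective A X₀] [Module.Projective A X₁] [Module.Finite A X₁]
    [Module.Projective A Y₀] [Module.Projective A Y₁]
    {dX : X₁ →ₗ[A] X₀} {pX : X₀ →ₗ[A] M} (hpX : Function.Surjective pX)
    (hX : Function.Exact dX pX)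
    {dY : Y₁ →ₗ[A] Y₀} {pY : Y₀ →ₗ[A] M} (hpY : Function.Surjective pY)
    (hY : Function.Exact dY pY) (j : ℕ)
    (h : Subsingleton (Abelian.Ext (ModuleCat.of Aᵐᵒᵖ (dualCoker dY)) (ModuleCat.of Aᵐᵒᵖ N)
      (j + 1))) :
    Subsingleton (Abelian.Ext (ModuleCat.of Aᵐᵒᵖ (dualCoker dX)) (ModuleCat.of Aᵐᵒᵖ N)
      (j + 1)) := by
  have lift_through {P B C D : Type u} [AddCommGroup P] [Module A P] [AddCommGroup B]
      [Module A B] [AddCommGroup C] [Module A C] [AddCommGroup D] [Module A D]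
      [Module.Projective A P] {d : B →ₗ[A] C} {p : C →ₗ[A] D} (hdp : Function.Exact d p)
      (t : P →ₗ[A] C) (ht : p ∘ₗ t = 0) : ∃ s : P →ₗ[A] B, d ∘ₗ s = t := by
    obtain ⟨s, hs⟩ := Module.projective_lifting_property d.rangeRestrict
      (t.codRestrict (LinearMap.range d) fun x ↦ (hdp _).1 (LinearMap.congr_fun ht x))
      d.surjective_rangeRestrict
    exact ⟨s, by
      ext x
      exact congrArg Subtype.val (LinearMap.congr_fun hs x)⟩
  obtain ⟨f₀, hf₀⟩ := Module.projective_lifting_property pY pX hpY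
  obtain ⟨g₀, hg₀⟩ := Module.projective_lifting_property pX pY hpX
  obtain ⟨f₁, hf₁⟩ := lift_through hY (f₀ ∘ₗ dX) (by
    rw [← LinearMap.comp_assoc, hf₀, hX.linearMap_comp_eq_zero])
  obtain ⟨g₁, hg₁⟩ := lift_through hX (g₀ ∘ₗ dY) (by
    rw [← LinearMap.comp_assoc, hg₀, hY.linearMap_comp_eq_zero])
  obtain ⟨s, hs⟩ := lift_through hX (LinearMap.id - g₀ ∘ₗ f₀) (by
    rw [LinearMap.comp_sub, ← LinearMap.comp_assoc, hg₀, hf₀, LinearMap.comp_id, sub_self])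
  let w : X₁ →ₗ[A] X₁ := LinearMap.id - g₁ ∘ₗ f₁ - s ∘ₗ dX
  have hw : dX ∘ₗ w = 0 := by
    simp only [w, LinearMap.comp_sub, ← LinearMap.comp_assoc, hs, hg₁, LinearMap.comp_id]
    rw [LinearMap.comp_assoc, hf₁]
    simp only [LinearMap.sub_comp, LinearMap.comp_assoc, LinearMap.id_comp]
    abel
  let a : dualCoker dX →ₗ[Aᵐᵒᵖ] dualCoker dY :=
    Submodule.mapQ _ _ (dualMap g₁) (by
      rintro _ ⟨φ, rfl⟩
      exact ⟨dualMap g₀ φ, by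
        change (φ ∘ₗ g₀) ∘ₗ dY = (φ ∘ₗ dX) ∘ₗ g₁
        rw [LinearMap.comp_assoc, LinearMap.comp_assoc, hg₁]⟩)
  let b : dualCoker dY →ₗ[Aᵐᵒᵖ] dualCoker dX :=
    Submodule.mapQ _ _ (dualMap f₁) (by
      rintro _ ⟨φ, rfl⟩
      exact ⟨dualMap f₀ φ, by
        change (φ ∘ₗ f₀) ∘ₗ dX = (φ ∘ₗ dY) ∘ₗ f₁
        rw [LinearMap.comp_assoc, LinearMap.comp_assoc, hf₁]⟩)
  let c : dualCoker dX →ₗ[Aᵐᵒᵖ] (X₁ →ₗ[A] A) :=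
    Submodule.liftQ _ (dualMap w) (by
      rintro _ ⟨φ, rfl⟩
      change (φ ∘ₗ dX) ∘ₗ w = 0
      rw [LinearMap.comp_assoc, hw, LinearMap.comp_zero])
  refine subsingleton_ext_of_id_eq_add a b c (Submodule.mkQ _) ?_ j h
  refine Submodule.linearMap_qext _ (LinearMap.ext fun φ ↦ ?_)
  change (Submodule.Quotient.mk ((φ ∘ₗ g₁) ∘ₗ f₁) : dualCoker dX) +
    Submodule.Quotient.mk (φ ∘ₗ w) = Submodule.Quotient.mk φ
  rw [← Submodule.Quotient.mk_add, Submodule.Quotient.eq]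
  refine ⟨-(φ ∘ₗ s), ?_⟩
  change (-(φ ∘ₗ s)) ∘ₗ dX = (φ ∘ₗ g₁) ∘ₗ f₁ + φ ∘ₗ w - φ
  ext x
  simp only [w, LinearMap.neg_comp, LinearMap.neg_apply, LinearMap.comp_apply,
    LinearMap.sub_apply, LinearMap.add_apply, LinearMap.id_apply, map_sub]
  abel

end Transpose

namespace ZSeq

variable {A : Type u} [Ring A] (S : ZSeq A)

/-- The differential between two consecutive positions of a sequence. -/
def map {i j : ℤ} (h : i = j + 1) : S.P i →ₗ[A] S.P j :=
  h ▸ S.d j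

variable {S}

lemma exact_map_iff {i j k : ℤ} (h : i = j + 1) (h' : j = k + 1) :
    Function.Exact (S.map h) (S.map h') ↔ Function.Exact (S.d (k + 1)) (S.d k) := by
  subst h'
  subst h
  rfl

lemma exact_comp_map_iff {i j k : ℤ} (h : i = j + 1) (h' : j = k + 1) :
    Function.Exact (fun φ : S.P k →ₗ[A] A ↦ φ.comp (S.map h'))
        (fun φ : S.P j →ₗ[A] A ↦ φ.comp (S.map h)) ↔
      Function.Exact (fun φ : S.P k →ₗ[A] A ↦ φ.comp (S.d k))
        (fun φ : S.P (k + 1) →ₗ[A] A ↦ φ.comp (S.d (k + 1))) := by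
  subst h'
  subst h
  rfl

/-- Transport of an augmentation along an equality of positions. -/
lemma exists_aug {M : Type u} [AddCommGroup M] [Module A M] {π : S.P 0 →ₗ[A] M}
    (hπ : Function.Surjective π) (hd : Function.Exact (S.d 0) π) {i : ℤ} (hi : i = 0) :
    ∃ p : S.P i →ₗ[A] M, Function.Surjective p ∧
      ∀ {k : ℤ} (h : k = i + 1), Function.Exact (S.map h) p := by
  subst hi
  refine ⟨π, hπ, ?_⟩
  rintro _ rfl
  exact hd

/-- `Ext^{j+1}(M, A)` is computed by the nonnegative part of the sequence. -/
lemma subsingleton_ext_iff {M : Type u} [AddCommGroup M] [Module A M] {π : S.P 0 →ₗ[A] M}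
    (hπ : Function.Surjective π) (hd : Function.Exact (S.d 0) π) (j : ℕ)
    (hP : ∀ i : ℤ, 0 ≤ i → i ≤ j → Module.Projective A (S.P i))
    (hS : ∀ i : ℤ, 0 ≤ i → i ≤ j → Function.Exact (S.d (i + 1)) (S.d i)) :
    Subsingleton (Abelian.Ext (ModuleCat.of A M) (ModuleCat.of A A) (j + 1)) ↔
      Function.Exact (fun φ : S.P j →ₗ[A] A ↦ φ.comp (S.d j))
        (fun φ : S.P (j + 1) →ₗ[A] A ↦ φ.comp (S.d (j + 1))) := by
  obtain ⟨p, hp, hdp⟩ := exists_aug hπ hd (i := ((0 : ℕ) : ℤ)) rfl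
  have := subsingleton_ext_iff_exact (N := A) j M (fun i : ℕ ↦ S.P i)
    (fun i ↦ S.map (Nat.cast_succ i)) p (fun i hi ↦ hP i (by lia) (by lia)) hp (hdp _)
    (fun i hi ↦ (exact_map_iff _ _).2 (hS i (by lia) (by lia)))
  rw [this, exact_comp_map_iff]

/-- The nonpositive part of the sequence computes `Ext^{j+1}` of the transpose. -/
lemma subsingleton_ext_transpose_iff {M : Type u} [AddCommGroup M] [Module A M]
    {π : S.P 0 →ₗ[A] M} (hπ : Function.Surjective π) (hd : Function.Exact (S.d 0) π)
    (F : FreeResolution A M) (j : ℕ)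
    (hP : ∀ i : ℤ, -j - 1 ≤ i → i ≤ 1 → Module.Finite A (S.P i) ∧ Module.Projective A (S.P i))
    (hS : ∀ i : ℤ, -j - 1 ≤ i → i < 0 →
      Function.Exact (fun φ : S.P i →ₗ[A] A => φ.comp (S.d i))
        (fun φ : S.P (i + 1) →ₗ[A] A => φ.comp (S.d (i + 1)))) :
    Subsingleton (Abelian.Ext (ModuleCat.of Aᵐᵒᵖ F.transpose) (ModuleCat.of Aᵐᵒᵖ A) (j + 1)) ↔
      Function.Exact (S.d (-j - 1 + 1)) (S.d (-j - 1)) := by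
  let e : ℕ → ℤ := fun i ↦ 1 - i
  have he (i : ℕ) : e i = e (i + 1) + 1 := by simp only [e]; lia
  obtain ⟨p, hp, hdp⟩ := exists_aug hπ hd (i := e 1) rfl
  have hfin (i : ℕ) (hi : i ≤ j + 2) : Module.Finite A (S.P (e i)) :=
    (hP (e i) (by simp only [e]; lia) (by simp only [e]; lia)).1
  have hproj (i : ℕ) (hi : i ≤ j + 2) : Module.Projective A (S.P (e i)) :=
    (hP (e i) (by simp only [e]; lia) (by simp only [e]; lia)).2
  have := hfin 0 (by lia)
  have := hproj 0 (by lia)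
  have := hproj 1 (by lia)
  have hcoker : Subsingleton (Abelian.Ext (ModuleCat.of Aᵐᵒᵖ F.transpose)
      (ModuleCat.of Aᵐᵒᵖ A) (j + 1)) ↔
      Subsingleton (Abelian.Ext (ModuleCat.of Aᵐᵒᵖ (dualCoker (S.map (he 0))))
      (ModuleCat.of Aᵐᵒᵖ A) (j + 1)) :=
    ⟨subsingleton_ext_dualCoker hp (hdp (he 0)) F.aug_surjective F.exact_aug j,
      subsingleton_ext_dualCoker F.aug_surjective F.exact_aug hp (hdp (he 0)) j⟩
  have hres := subsingleton_ext_iff_exact (N := A) j (dualCoker (S.map (he 0)))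
    (fun i : ℕ ↦ S.P (e i) →ₗ[A] A) (fun i ↦ dualMap (S.map (he i))) (Submodule.mkQ _)
    (fun i hi ↦ by
      have := hfin i (by lia)
      have := hproj i (by lia)
      exact projective_dual A _) (Submodule.mkQ_surjective _)
    (LinearMap.exact_iff.2 (Submodule.ker_mkQ _))
    (fun i hi ↦ (exact_comp_map_iff _ _).2
      (hS _ (by simp only [e]; lia) (by simp only [e]; lia)))
  have hev (i : ℕ) (hi : i ≤ j + 2) : Function.Bijective (evalBidual A Aᵐᵒᵖ A (S.P (e i))) := by
    have := hfin i hi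
    have := hproj i hi
    exact bijective_evalBidual_self A _
  have hdual := exact_bidual_iff Aᵐᵒᵖ A (f := S.map (he j)) (g := S.map (he (j + 1)))
    (hev j (by lia)) (hev (j + 1) (by lia)) (hev (j + 2) (by lia))
  have hend : e (j + 2) = -j - 1 := by simp only [e]; lia
  rw [hcoker, hres, ← hend, ← exact_map_iff (he j) (he (j + 1)), ← hdual]
  rfl

end ZSeq

section Splice

variable {A : Type u} [Ring A] {M : Type u} [AddCommGroup M] [Module A M]

/-- The modules of the splice of a free resolution of `M` with the dual of a free resolution
of the kernel of `F₀* → F₁*`. -/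
def spliceModule (F : FreeResolution A M)
    (G : FreeResolution Aᵐᵒᵖ (LinearMap.ker (dualMap (F.d 0)))) : ℤ → ModuleCat.{u} A
  | Int.ofNat k => ModuleCat.of A (Fin (F.rank k) → A)
  | Int.negSucc k => ModuleCat.of A ((Fin (G.rank k) → Aᵐᵒᵖ) →ₗ[Aᵐᵒᵖ] A)

/-- The splice of a free resolution `F` of `M` with the dual of a free resolution of the
kernel of `F₀* → F₁*`. -/
def splice (F : FreeResolution A M)
    (G : FreeResolution Aᵐᵒᵖ (LinearMap.ker (dualMap (F.d 0)))) : ZSeq A where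
  P i := spliceModule F G i
  d
    | Int.ofNat k => F.d k
    | Int.negSucc 0 =>
      LinearMap.lcomp A A ((LinearMap.ker (dualMap (F.d 0))).subtype ∘ₗ G.aug) ∘ₗ
        evalBidual A Aᵐᵒᵖ A (Fin (F.rank 0) → A)
    | Int.negSucc (k + 1) => LinearMap.lcomp A A (G.d k)

variable (F : FreeResolution A M) (G : FreeResolution Aᵐᵒᵖ (LinearMap.ker (dualMap (F.d 0))))

lemma finite_and_projective_splice (i : ℤ) :
    Module.Finite A ((splice F G).P i) ∧ Module.Projective A ((splice F G).P i) := by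
  cases i with
  | ofNat k =>
    change Module.Finite A (Fin (F.rank k) → A) ∧ Module.Projective A (Fin (F.rank k) → A)
    exact ⟨inferInstance, inferInstance⟩
  | negSucc k =>
    exact finite_and_projective_dual (R := Aᵐᵒᵖ) (X := Fin (G.rank k) → Aᵐᵒᵖ) (T := A) A

lemma exact_splice (i : ℤ) (hi : 0 ≤ i) :
    Function.Exact ((splice F G).d (i + 1)) ((splice F G).d i) := by
  lift i to ℕ using hi
  exact F.exact i

lemma exact_dual_splice (i : ℤ) (hi : i < 0) :
    Function.Exact (fun φ : (splice F G).P i →ₗ[A] A ↦ φ.comp ((splice F G).d i))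
      (fun φ : (splice F G).P (i + 1) →ₗ[A] A ↦ φ.comp ((splice F G).d (i + 1))) := by
  have hev (k : ℕ) := bijective_evalBidual_op A (Fin (G.rank k) → Aᵐᵒᵖ)
  match i, hi with
  | Int.negSucc 0, _ =>
    change Function.Exact
      (fun φ : ((Fin (G.rank 0) → Aᵐᵒᵖ) →ₗ[Aᵐᵒᵖ] A) →ₗ[A] A ↦
        φ.comp (LinearMap.lcomp A A ((LinearMap.ker (dualMap (F.d 0))).subtype ∘ₗ G.aug) ∘ₗ
          evalBidual A Aᵐᵒᵖ A (Fin (F.rank 0) → A)))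
      (dualMap (F.d 0))
    intro φ
    constructor
    · intro hφ
      obtain ⟨x, hx⟩ := G.aug_surjective ⟨φ, hφ⟩
      exact ⟨evalBidual Aᵐᵒᵖ A A _ x, congrArg Subtype.val hx⟩
    · rintro ⟨θ, rfl⟩
      obtain ⟨x, rfl⟩ := (hev 0).2 θ
      exact (G.aug x).2
  | Int.negSucc 1, _ =>
    change Function.Exact
      (fun φ : ((Fin (G.rank 1) → Aᵐᵒᵖ) →ₗ[Aᵐᵒᵖ] A) →ₗ[A] A ↦
        φ.comp (LinearMap.lcomp A A (G.d 0)))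
      (fun φ : ((Fin (G.rank 0) → Aᵐᵒᵖ) →ₗ[Aᵐᵒᵖ] A) →ₗ[A] A ↦
        φ.comp (LinearMap.lcomp A A ((LinearMap.ker (dualMap (F.d 0))).subtype ∘ₗ G.aug) ∘ₗ
          evalBidual A Aᵐᵒᵖ A (Fin (F.rank 0) → A)))
    intro θ
    obtain ⟨x, rfl⟩ := (hev 0).2 θ
    change ((G.aug x : LinearMap.ker (dualMap (F.d 0))) : (Fin (F.rank 0) → A) →ₗ[A] A) = 0 ↔ _
    rw [Submodule.coe_eq_zero, G.exact_aug x]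
    constructor
    · rintro ⟨y, rfl⟩
      exact ⟨evalBidual Aᵐᵒᵖ A A _ y, rfl⟩
    · rintro ⟨θ, hθ⟩
      obtain ⟨y, rfl⟩ := (hev 1).2 θ
      exact ⟨y, (hev 0).1 hθ⟩
  | Int.negSucc (k + 2), _ =>
    exact (exact_bidual_iff A A (hev (k + 2)) (hev (k + 1)) (hev k)).2 (G.exact k)

end Splice

/-- **Theorem 1.1 / 2.2 (1)⇔(2) (Araya–Takahashi).**
Let `Λ` be a left and right noetherian ring, `m, n ∈ ℕ ∪ {∞}` and `M` a finitely
generated (right) `Λ`-module.  Then `M` is `(m,n)`-torsionfree if and only if there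
exists an exact sequence `P_{m+1} → P_m → ⋯ → P_0 →∂ P_{-1} → ⋯ → P_{-n}` of
finitely generated projective `Λ`-modules whose `Λ`-dual is also exact and such
that the image of `∂` is isomorphic to `M`.

The sequence is encoded by a `ℤ`-indexed family `S` together with an epimorphism
`π : P_0 → M` onto the image of `∂ = S.d (-1)`: exactness of
`P_1 → P_0 → M → 0` together with `ker ∂ = ker π` (required as soon as `n ≥ 1`,
i.e. as soon as `∂` is part of the displayed sequence) says precisely that the
image of `∂` is isomorphic to `M`; exactness (and exactness of the dual) is
required at all interior nodes `-n + 1 ≤ i ≤ m` of the displayed sequence. -/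
theorem isMNTorsionFree_iff_exists_proj_sequence
    (A : Type u) [Ring A] [IsNoetherianRing A] [IsNoetherianRing Aᵐᵒᵖ]
    (M : Type u) [AddCommGroup M] [Module A M] [Module.Finite A M] (m n : ℕ∞) :
    IsMNTorsionFree A M m n ↔
      ∃ (S : ZSeq A) (π : S.P 0 →ₗ[A] M),
        (∀ i : ℤ, posIn m n i →
          Module.Finite A (S.P i) ∧ Module.Projective A (S.P i)) ∧
        Function.Surjective π ∧
        Function.Exact (S.d 0) π ∧
        (1 ≤ n → LinearMap.ker (S.d (-1)) = LinearMap.ker π) ∧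
        (∀ i : ℤ, nodeIn m n (i + 1) → Function.Exact (S.d (i + 1)) (S.d i)) ∧
        (∀ i : ℤ, nodeIn m n (i + 1) →
          Function.Exact (fun φ : S.P i →ₗ[A] A => φ.comp (S.d i))
            (fun φ : S.P (i + 1) →ₗ[A] A => φ.comp (S.d (i + 1)))) := by
  have aux (j : ℕ) (i : ℕ) (k : ℕ∞) (hij : i ≤ j + 1) (hj : (j : ℕ∞) + 1 ≤ k) :
      (i : ℕ∞) ≤ k :=
    le_trans (by exact_mod_cast hij) hj
  constructor
  · rintro ⟨hM, htr⟩
    obtain ⟨F⟩ := nonempty_freeResolution A M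
    obtain ⟨G⟩ := nonempty_freeResolution Aᵐᵒᵖ (LinearMap.ker (dualMap (F.d 0)))
    have hS (i : ℤ) (hi : nodeIn m n (i + 1)) :
        Function.Exact ((splice F G).d (i + 1)) ((splice F G).d i) := by
      rcases le_or_gt 0 i with h0 | h0
      · exact exact_splice F G i h0
      · obtain ⟨j, rfl⟩ : ∃ j : ℕ, i = -j - 1 := ⟨(-i - 1).toNat, by lia⟩
        refine (ZSeq.subsingleton_ext_transpose_iff F.aug_surjective F.exact_aug F j
          (fun i _ _ ↦ finite_and_projective_splice F G i)
          (fun i _ hi ↦ exact_dual_splice F G i hi)).1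
          ((extVanish_iff_subsingleton_ext A j).1 (htr F j ?_))
        have := hi.2 (by lia)
        rwa [show (1 - (-(j : ℤ) - 1 + 1)).toNat = j + 1 by lia, Nat.cast_add_one] at this
    refine ⟨splice F G, F.aug, fun i _ ↦ finite_and_projective_splice F G i, F.aug_surjective,
      F.exact_aug, fun hn ↦ ?_, hS, fun i hi ↦ ?_⟩
    · have h0 := LinearMap.exact_iff.1 (hS (-1) ⟨by simp, by simpa using hn⟩)
      exact h0.trans (LinearMap.exact_iff.1 F.exact_aug).symm
    · rcases lt_or_ge i 0 with h0 | h0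
      · exact exact_dual_splice F G i h0
      · obtain ⟨j, rfl⟩ := Int.eq_ofNat_of_zero_le h0
        refine (ZSeq.subsingleton_ext_iff (S := splice F G) F.aug_surjective F.exact_aug j
          (fun i _ _ ↦ (finite_and_projective_splice F G i).2)
          (fun i hi _ ↦ exact_splice F G i hi)).1
          ((extVanish_iff_subsingleton_ext A j).1 (hM j ?_))
        have := hi.1 (by lia)
        rwa [show ((j : ℤ) + 1).toNat = j + 1 by lia, Nat.cast_add_one] at this
  · rintro ⟨S, π, hP, hπ, hdπ, -, hS, hdual⟩
    refine ⟨fun j hj ↦ ?_, fun F j hj ↦ ?_⟩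
    · rw [extVanish_iff_subsingleton_ext, ZSeq.subsingleton_ext_iff hπ hdπ]
      · exact hdual j ⟨fun _ ↦ aux j _ m (by lia) hj, fun _ ↦ by lia⟩
      · exact fun i h0 hi ↦
          (hP i ⟨fun _ ↦ (aux j _ m (by lia) hj).trans le_self_add, fun _ ↦ by lia⟩).2
      · exact fun i h0 hi ↦ hS i ⟨fun _ ↦ aux j _ m (by lia) hj, fun _ ↦ by lia⟩
    · rw [extVanish_iff_subsingleton_ext, ZSeq.subsingleton_ext_transpose_iff hπ hdπ]
      · exact hS _ ⟨fun _ ↦ by lia, fun _ ↦ aux j _ n (by lia) hj⟩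
      · exact fun i h0 hi ↦ hP i ⟨fun _ ↦ le_trans (by exact_mod_cast (by lia : i.toNat ≤ 1))
          (le_add_self : 1 ≤ m + 1), fun _ ↦ aux j _ n (by lia) hj⟩
      · exact fun i h0 hi ↦ hdual i ⟨fun _ ↦ by lia, fun _ ↦ aux j _ n (by lia) hj⟩
end

section
/- Let Λ be a left and right noetherian ring, let n ∈ ℕ ∪ {∞}, and let M be a finitely generated right Λ-module. Suppose there is an exact sequence σ : 0 → M → G_{-1} → G_{-2} → ⋯ → G_{-n} of finitely generated Λ-modules such that each G_i (−n ≤ i ≤ −1) is (0,n)-torsionfree (i.e., n-torsionfree) and such that the Λ-dual sequence σ* is also exact. Then M is (0,n)-torsionfree. -/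
/-!
Formalization of a statement from:
T. Araya and R. Takahashi, "On reducing homological dimensions over noetherian
rings" (arXiv:2010.10765).
-/

open Function Filter CategoryTheory

universe u

/-- An `ℕ`-indexed sequence of `A`-modules `G_0 → G_1 → G_2 → ⋯`. -/
structure CoSeq (A : Type u) [Ring A] where
  G : ℕ → Type u
  [acg : ∀ i, AddCommGroup (G i)]
  [mod : ∀ i, Module A (G i)]
  d : ∀ i : ℕ, G i →ₗ[A] G (i + 1)

attribute [instance] CoSeq.acg CoSeq.mod

open Abelian

section ExtSequences

variable {R : Type u} [Ring R] {X₁ X₂ X₃ N : Type u}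
  [AddCommGroup X₁] [Module R X₁] [AddCommGroup X₂] [Module R X₂]
  [AddCommGroup X₃] [Module R X₃] [AddCommGroup N] [Module R N]

/-- `Ext_R^i(X, N) = 0`, in terms of the `Ext`-groups of the category of `R`-modules. -/
def ExtZero (R : Type u) [Ring R] (X N : Type u) [AddCommGroup X] [Module R X]
    [AddCommGroup N] [Module R N] (i : ℕ) : Prop :=
  Subsingleton (Ext (ModuleCat.of R X) (ModuleCat.of R N) i)

theorem exists_shortExact_moduleCat {f : X₁ →ₗ[R] X₂} {g : X₂ →ₗ[R] X₃}
    (hf : Injective f) (hfg : Exact f g) (hg : Surjective g) :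
    ∃ w : ModuleCat.ofHom f ≫ ModuleCat.ofHom g = 0,
      (ShortComplex.mk (ModuleCat.ofHom f) (ModuleCat.ofHom g) w).ShortExact := by
  refine ⟨?_, ModuleCat.shortComplex_shortExact _ hfg hf hg⟩
  ext x
  exact hfg.apply_apply_eq_zero x

theorem extZero_succ_of_projective [Module.Projective R X₂] (i : ℕ) :
    ExtZero R X₂ N (i + 1) := by
  have : Projective (ModuleCat.of R X₂) :=
    (IsProjective.iff_projective (R := R) X₂).mp inferInstance
  exact Ext.subsingleton_of_projective _ _ _

theorem extZero_one_of_forall_extends {f : X₁ →ₗ[R] X₂} {g : X₂ →ₗ[R] X₃}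
    (hf : Injective f) (hfg : Exact f g) (hg : Surjective g)
    (h : ∀ φ : X₁ →ₗ[R] N, ∃ ψ : X₂ →ₗ[R] N, ψ.comp f = φ) (h₂ : ExtZero R X₂ N 1) :
    ExtZero R X₃ N 1 := by
  obtain ⟨w, hS⟩ := exists_shortExact_moduleCat hf hfg hg
  refine subsingleton_of_forall_eq 0 fun x => ?_
  obtain ⟨y, rfl⟩ := Ext.contravariant_sequence_exact₃ hS (ModuleCat.of R N) x
    (h₂.elim _ _) (add_zero 1)
  obtain ⟨φ, rfl⟩ := (Ext.mk₀_bijective _ _).2 y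
  obtain ⟨ψ, hψ⟩ := h φ.hom
  have : φ = ModuleCat.ofHom f ≫ ModuleCat.ofHom ψ := by
    ext x
    exact (LinearMap.congr_fun hψ x).symm
  rw [this, ← Ext.mk₀_comp_mk₀]
  exact hS.extClass_comp_assoc _

theorem extZero_succ_of_extZero {f : X₁ →ₗ[R] X₂} {g : X₂ →ₗ[R] X₃}
    (hf : Injective f) (hfg : Exact f g) (hg : Surjective g) {i : ℕ}
    (h₁ : ExtZero R X₁ N i) (h₂ : ExtZero R X₂ N (i + 1)) :
    ExtZero R X₃ N (i + 1) := by
  obtain ⟨w, hS⟩ := exists_shortExact_moduleCat hf hfg hg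
  refine subsingleton_of_forall_eq 0 fun x => ?_
  obtain ⟨y, rfl⟩ := Ext.contravariant_sequence_exact₃ hS (ModuleCat.of R N) x
    (h₂.elim _ _) (add_comm 1 i)
  rw [h₁.elim y 0, Ext.comp_zero]

theorem exists_extends_of_extZero_one {f : X₁ →ₗ[R] X₂} {g : X₂ →ₗ[R] X₃}
    (hf : Injective f) (hfg : Exact f g) (hg : Surjective g)
    (h₃ : ExtZero R X₃ N 1) (φ : X₁ →ₗ[R] N) :
    ∃ ψ : X₂ →ₗ[R] N, ψ.comp f = φ := by
  obtain ⟨w, hS⟩ := exists_shortExact_moduleCat hf hfg hg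
  obtain ⟨y, hy⟩ := Ext.contravariant_sequence_exact₁ hS (ModuleCat.of R N)
    (Ext.mk₀ (ModuleCat.ofHom φ)) (add_zero 1) (h₃.elim _ _)
  obtain ⟨ψ, rfl⟩ := (Ext.mk₀_bijective _ _).2 y
  rw [Ext.mk₀_comp_mk₀] at hy
  have := (Ext.mk₀_bijective _ _).1 hy
  exact ⟨ψ.hom, congrArg ModuleCat.Hom.hom this⟩

theorem extZero_of_extZero_succ {f : X₁ →ₗ[R] X₂} {g : X₂ →ₗ[R] X₃}
    (hf : Injective f) (hfg : Exact f g) (hg : Surjective g) {i : ℕ}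
    (h₂ : ExtZero R X₂ N i) (h₃ : ExtZero R X₃ N (i + 1)) :
    ExtZero R X₁ N i := by
  obtain ⟨w, hS⟩ := exists_shortExact_moduleCat hf hfg hg
  refine subsingleton_of_forall_eq 0 fun x => ?_
  obtain ⟨y, rfl⟩ := Ext.contravariant_sequence_exact₁ hS (ModuleCat.of R N) x
    (add_comm 1 i) (h₃.elim _ _)
  rw [h₂.elim y 0, Ext.comp_zero]

theorem extZero_one_iff_forall_extends [Module.Projective R X₂] {f : X₁ →ₗ[R] X₂}
    {g : X₂ →ₗ[R] X₃} (hf : Injective f) (hfg : Exact f g) (hg : Surjective g) :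
    ExtZero R X₃ N 1 ↔ ∀ φ : X₁ →ₗ[R] N, ∃ ψ : X₂ →ₗ[R] N, ψ.comp f = φ :=
  ⟨exists_extends_of_extZero_one hf hfg hg,
    fun h => extZero_one_of_forall_extends hf hfg hg h (extZero_succ_of_projective 0)⟩

theorem extZero_add_two_iff [Module.Projective R X₂] {f : X₁ →ₗ[R] X₂}
    {g : X₂ →ₗ[R] X₃} (hf : Injective f) (hfg : Exact f g) (hg : Surjective g) (i : ℕ) :
    ExtZero R X₃ N (i + 2) ↔ ExtZero R X₁ N (i + 1) :=
  ⟨extZero_of_extZero_succ hf hfg hg (extZero_succ_of_projective i),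
    fun h => extZero_succ_of_extZero hf hfg hg h (extZero_succ_of_projective (i + 1))⟩

end ExtSequences

section Factorization

variable {R : Type u} [Ring R] {X Y Z N : Type u} [AddCommGroup X] [Module R X]
  [AddCommGroup Y] [Module R Y] [AddCommGroup Z] [Module R Z] [AddCommGroup N] [Module R N]
  {f : X →ₗ[R] Y} {g : Y →ₗ[R] Z}

theorem exists_comp_eq_of_exact (hfg : Exact f g) (hg : Surjective g) {φ : Y →ₗ[R] N}
    (hφ : ∀ x, φ (f x) = 0) : ∃ χ : Z →ₗ[R] N, χ.comp g = φ := by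
  have hker : LinearMap.ker g ≤ LinearMap.ker φ := fun y hy => by
    obtain ⟨x, rfl⟩ := (hfg y).1 hy
    exact hφ x
  refine ⟨((LinearMap.ker g).liftQ φ hker).comp
    (g.quotKerEquivOfSurjective hg).symm.toLinearMap, LinearMap.ext fun y => ?_⟩
  have : (g.quotKerEquivOfSurjective hg).symm (g y) = Submodule.Quotient.mk y :=
    (LinearEquiv.symm_apply_eq _).2 rfl
  simp [this]

theorem dualMap_injective_of_surjective (hg : Surjective g) : Injective (dualMap g) :=
  fun φ ψ h => LinearMap.ext fun z => by
    obtain ⟨y, rfl⟩ := hg z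
    exact LinearMap.congr_fun h y

theorem exact_dualMap (hfg : Exact f g) (hg : Surjective g) :
    Exact (dualMap g) (dualMap f) := by
  refine fun φ => ⟨fun hφ => exists_comp_eq_of_exact hfg hg (LinearMap.congr_fun hφ), ?_⟩
  rintro ⟨χ, rfl⟩
  refine LinearMap.ext fun x => ?_
  change χ (g (f x)) = 0
  rw [hfg.apply_apply_eq_zero, map_zero]

end Factorization

section Resolutions

variable {R : Type u} [Ring R]

/-- The resolution of the first syzygy obtained by truncating a free resolution. -/
def FreeResolution.syzygy {X : Type u} [AddCommGroup X] [Module R X]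
    (F : FreeResolution R X) : FreeResolution R (LinearMap.ker F.aug) where
  rank i := F.rank (i + 1)
  d i := F.d (i + 1)
  aug := (F.d 0).codRestrict _ F.exact_aug.apply_apply_eq_zero
  aug_surjective := by
    rintro ⟨x, hx⟩
    obtain ⟨y, rfl⟩ := (F.exact_aug x).1 hx
    exact ⟨y, rfl⟩
  exact_aug x := by
    rw [← F.exact 0 x, Subtype.ext_iff]
    rfl
  exact i := F.exact (i + 1)

theorem FreeResolution.exact_comp_iff_extZero {N : Type u} [AddCommGroup N] [Module R N]
    (j : ℕ) : ∀ {X : Type u} [AddCommGroup X] [Module R X] (F : FreeResolution R X),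
    Exact (fun φ : (Fin (F.rank j) → R) →ₗ[R] N => φ.comp (F.d j))
      (fun φ : (Fin (F.rank (j + 1)) → R) →ₗ[R] N => φ.comp (F.d (j + 1))) ↔
    ExtZero R X N (j + 1) := by
  induction j with
  | zero =>
    intro X _ _ F
    rw [extZero_one_iff_forall_extends (LinearMap.ker F.aug).injective_subtype
      (LinearMap.exact_subtype_ker_map F.aug) F.aug_surjective]
    constructor
    · intro h φ
      obtain ⟨ψ, hψ⟩ := (h (φ.comp F.syzygy.aug)).1 (LinearMap.ext fun x =>
        (congrArg φ (F.syzygy.exact_aug.apply_apply_eq_zero x)).trans (map_zero φ))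
      refine ⟨ψ, LinearMap.ext fun x => ?_⟩
      obtain ⟨y, rfl⟩ := F.syzygy.aug_surjective x
      exact LinearMap.congr_fun hψ y
    · intro h φ
      constructor
      · intro hφ
        obtain ⟨χ, hχ⟩ : ∃ χ : LinearMap.ker F.aug →ₗ[R] N, χ.comp F.syzygy.aug = φ :=
          exists_comp_eq_of_exact F.syzygy.exact_aug F.syzygy.aug_surjective
            (LinearMap.congr_fun hφ)
        obtain ⟨ψ, hψ⟩ := h χ
        exact ⟨ψ, by rw [← hχ, ← hψ]; rfl⟩
      · rintro ⟨ψ, rfl⟩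
        exact LinearMap.ext fun x =>
          (congrArg ψ ((F.exact 0).apply_apply_eq_zero x)).trans (map_zero ψ)
  | succ j ih =>
    intro X _ _ F
    rw [extZero_add_two_iff (LinearMap.ker F.aug).injective_subtype
      (LinearMap.exact_subtype_ker_map F.aug) F.aug_surjective]
    exact ih F.syzygy

theorem nonempty_freeResolution_s3 [IsNoetherianRing R] (X : Type u) [AddCommGroup X]
    [Module R X] [Module.Finite R X] : Nonempty (FreeResolution R X) := by
  obtain ⟨r, π, hπ⟩ := Module.Finite.exists_fin' R X
  choose s p hp using fun t : Σ r : ℕ, Submodule R (Fin r → R) =>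
    Module.Finite.exists_fin' R t.2
  let t : ℕ → Σ r : ℕ, Submodule R (Fin r → R) := fun i =>
    Nat.rec ⟨r, LinearMap.ker π⟩ (fun _ t => ⟨s t, LinearMap.ker (p t)⟩) i
  exact ⟨{
    rank := fun i => (t i).1
    d := fun i => (t i).2.subtype.comp (p (t i))
    aug := π
    aug_surjective := hπ
    exact_aug := fun x =>
      ⟨fun hx => (hp (t 0) ⟨x, hx⟩).imp fun y hy => congrArg Subtype.val hy,
        fun ⟨y, hy⟩ => hy ▸ (p (t 0) y).2⟩
    exact := fun i x =>
      ⟨fun hx => (hp (t (i + 1)) ⟨x, Subtype.ext hx⟩).imp fun y hy => congrArg Subtype.val hy,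
        fun ⟨y, hy⟩ => hy ▸ congrArg Subtype.val (p (t (i + 1)) y).2⟩ }⟩

theorem extVanish_iff_extZero [IsNoetherianRing R] {X N : Type u} [AddCommGroup X]
    [Module R X] [Module.Finite R X] [AddCommGroup N] [Module R N] (j : ℕ) :
    ExtVanish R X N j ↔ ExtZero R X N (j + 1) := by
  obtain ⟨F⟩ := nonempty_freeResolution_s3 (R := R) X
  exact ⟨fun h => (F.exact_comp_iff_extZero j).1 (h F),
    fun h F' => (F'.exact_comp_iff_extZero j).2 h⟩

end Resolutions

section Duality

variable {A : Type u} [Ring A]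

/-- The dual of `A^r` is the free `Aᵐᵒᵖ`-module of rank `r`. -/
noncomputable def dualPiEquiv (r : ℕ) :
    ((Fin r → A) →ₗ[A] A) ≃ₗ[Aᵐᵒᵖ] (Fin r → Aᵐᵒᵖ) :=
  LinearEquiv.ofBijective
    { toFun := fun φ i => MulOpposite.op (φ (Pi.single i 1))
      map_add' := fun _ _ => rfl
      map_smul' := fun _ _ => rfl }
    ⟨fun φ ψ h => LinearMap.pi_ext' fun i => LinearMap.ext_ring
        (MulOpposite.op_injective (congrFun h i)),
      fun v => ⟨Fintype.linearCombination A fun i => (v i).unop, by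
        funext i
        simp [Fintype.linearCombination_apply_single]⟩⟩

instance dualPi_projective (r : ℕ) : Module.Projective Aᵐᵒᵖ ((Fin r → A) →ₗ[A] A) :=
  Module.Projective.of_equiv (dualPiEquiv r).symm

instance dualPi_finite (r : ℕ) : Module.Finite Aᵐᵒᵖ ((Fin r → A) →ₗ[A] A) :=
  Module.Finite.equiv (dualPiEquiv r).symm

theorem exists_eq_eval_of_dualPi {r : ℕ} (ξ : ((Fin r → A) →ₗ[A] A) →ₗ[Aᵐᵒᵖ] A) :
    ∃ p : Fin r → A, ∀ f : (Fin r → A) →ₗ[A] A, ξ f = f p := by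
  refine ⟨fun i => ξ (LinearMap.proj i), fun f => ?_⟩
  have hf : f = ∑ i, MulOpposite.op (f (Pi.single i 1)) • LinearMap.proj (φ := fun _ => A) i := by
    refine LinearMap.pi_ext' fun i => LinearMap.ext_ring ?_
    simp [Pi.single_apply]
  conv_lhs => rw [hf]
  simp only [map_sum, map_smul]
  conv_rhs => rw [LinearMap.pi_apply_eq_sum_univ f]
  refine Finset.sum_congr rfl fun i _ => ?_
  have : (fun j => if i = j then (1 : A) else 0) = Pi.single i 1 := by
    funext j
    simp [Pi.single_apply, eq_comm]
  rw [this]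
  rfl

/-- Evaluation at an element of `M`, as an element of the bidual of `M`. -/
def bidualEval {M : Type u} [AddCommGroup M] [Module A M] (m : M) :
    (M →ₗ[A] A) →ₗ[Aᵐᵒᵖ] A where
  toFun f := f m
  map_add' _ _ := rfl
  map_smul' _ _ := rfl

/-- `n`-torsionfreeness in terms of the biduality map `M → M**` and of `Ext(M*, A)`. -/
structure IsBidualTorsionFree (A : Type u) [Ring A] (M : Type u) [AddCommGroup M] [Module A M]
    (n : ℕ) : Prop where
  eval_injective : 1 ≤ n → ∀ m : M, (∀ f : M →ₗ[A] A, f m = 0) → m = 0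
  eval_surjective : 2 ≤ n → ∀ ξ : (M →ₗ[A] A) →ₗ[Aᵐᵒᵖ] A, ∃ m : M, ∀ f, ξ f = f m
  extZero_dual : ∀ j : ℕ, j + 3 ≤ n → ExtZero Aᵐᵒᵖ (M →ₗ[A] A) A (j + 1)

section Transpose

variable {M : Type u} [AddCommGroup M] [Module A M] (F : FreeResolution A M)

theorem FreeResolution.exact_dualMap_aug :
    Exact (dualMap F.aug) (dualMap (F.d 0)).rangeRestrict := fun φ => by
  rw [← exact_dualMap F.exact_aug F.aug_surjective φ, Subtype.ext_iff]
  rfl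

theorem FreeResolution.exact_range_mkQ :
    Exact (LinearMap.range (dualMap (F.d 0))).subtype
      (LinearMap.range (dualMap (F.d 0))).mkQ :=
  LinearMap.exact_subtype_mkQ _

theorem FreeResolution.extZero_transpose_one_iff :
    ExtZero Aᵐᵒᵖ F.transpose A 1 ↔ ∀ m : M, (∀ f : M →ₗ[A] A, f m = 0) → m = 0 := by
  rw [extZero_one_iff_forall_extends (Submodule.injective_subtype _) F.exact_range_mkQ
    (Submodule.mkQ_surjective _)]
  constructor
  · intro h m hm
    obtain ⟨p, rfl⟩ := F.aug_surjective m
    obtain ⟨χ, hχ⟩ := exists_comp_eq_of_exact (R := Aᵐᵒᵖ)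
      (Z := LinearMap.range (dualMap (F.d 0))) (f := dualMap F.aug)
      (g := (dualMap (F.d 0)).rangeRestrict) (φ := bidualEval p) F.exact_dualMap_aug
      (LinearMap.surjective_rangeRestrict _) hm
    obtain ⟨ψ, hψ⟩ := h χ
    obtain ⟨q, hq⟩ := exists_eq_eval_of_dualPi ψ
    have hpq : p = F.d 0 q := by
      funext i
      have h₁ := LinearMap.congr_fun hχ (LinearMap.proj i)
      rw [← hψ] at h₁
      exact h₁.symm.trans (hq _)
    rw [hpq]
    exact F.exact_aug.apply_apply_eq_zero q
  · intro h φ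
    obtain ⟨p, hp⟩ := exists_eq_eval_of_dualPi (φ.comp (dualMap (F.d 0)).rangeRestrict)
    obtain ⟨q, rfl⟩ := (F.exact_aug p).1 (h _ fun f => by
      have h₁ := hp (dualMap F.aug f)
      rw [LinearMap.comp_apply, F.exact_dualMap_aug.apply_apply_eq_zero, map_zero] at h₁
      exact h₁.symm)
    refine ⟨bidualEval q, LinearMap.ext fun y => ?_⟩
    obtain ⟨f, rfl⟩ := LinearMap.surjective_rangeRestrict _ y
    exact (hp f).symm

theorem FreeResolution.extZero_transpose_two_iff :
    ExtZero Aᵐᵒᵖ F.transpose A 2 ↔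
      ∀ ξ : (M →ₗ[A] A) →ₗ[Aᵐᵒᵖ] A, ∃ m : M, ∀ f, ξ f = f m := by
  rw [extZero_add_two_iff (Submodule.injective_subtype _) F.exact_range_mkQ
    (Submodule.mkQ_surjective _), extZero_one_iff_forall_extends
    (dualMap_injective_of_surjective F.aug_surjective) F.exact_dualMap_aug
    (LinearMap.surjective_rangeRestrict _)]
  refine forall_congr' fun ξ => ⟨?_, ?_⟩
  · rintro ⟨ψ, rfl⟩
    obtain ⟨p, hp⟩ := exists_eq_eval_of_dualPi ψ
    exact ⟨F.aug p, fun f => hp _⟩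
  · rintro ⟨m, hm⟩
    obtain ⟨p, rfl⟩ := F.aug_surjective m
    exact ⟨bidualEval p, LinearMap.ext fun f => (hm f).symm⟩

theorem FreeResolution.extZero_transpose_add_three_iff (j : ℕ) :
    ExtZero Aᵐᵒᵖ F.transpose A (j + 3) ↔ ExtZero Aᵐᵒᵖ (M →ₗ[A] A) A (j + 1) := by
  rw [extZero_add_two_iff (Submodule.injective_subtype _) F.exact_range_mkQ
    (Submodule.mkQ_surjective _) (j + 1), extZero_add_two_iff
    (dualMap_injective_of_surjective F.aug_surjective) F.exact_dualMap_aug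
    (LinearMap.surjective_rangeRestrict _)]

theorem FreeResolution.isBidualTorsionFree_iff (n : ℕ) :
    IsBidualTorsionFree A M n ↔ ∀ j, j + 1 ≤ n → ExtZero Aᵐᵒᵖ F.transpose A (j + 1) := by
  constructor
  · rintro ⟨h₁, h₂, h₃⟩ (_ | _ | j) hj
    · exact F.extZero_transpose_one_iff.2 (h₁ hj)
    · exact F.extZero_transpose_two_iff.2 (h₂ hj)
    · exact (F.extZero_transpose_add_three_iff j).2 (h₃ j hj)
  · intro h
    exact ⟨fun hn => F.extZero_transpose_one_iff.1 (h 0 hn),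
      fun hn => F.extZero_transpose_two_iff.1 (h 1 hn),
      fun j hj => (F.extZero_transpose_add_three_iff j).1 (h (j + 2) hj)⟩

end Transpose

theorem IsBidualTorsionFree.of_shortExact {M G N : Type u} [AddCommGroup M] [Module A M]
    [AddCommGroup G] [Module A G] [AddCommGroup N] [Module A N] {ι : M →ₗ[A] G}
    {π : G →ₗ[A] N} (hι : Injective ι) (hιπ : Exact ι π) (hπ : Surjective π)
    (hdual : Surjective (dualMap ι)) {n : ℕ} (hG : IsBidualTorsionFree A G (n + 1))
    (hN : IsBidualTorsionFree A N n) : IsBidualTorsionFree A M (n + 1) := by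
  have hπ' := dualMap_injective_of_surjective hπ
  have hex := exact_dualMap hιπ hπ
  refine ⟨fun hn m hm => ?_, fun hn ξ => ?_, fun j hj => ?_⟩
  · exact hι ((hG.eval_injective hn _ fun f => hm (f.comp ι)).trans (map_zero ι).symm)
  · obtain ⟨g, hg⟩ := hG.eval_surjective hn (ξ.comp (dualMap ι))
    obtain ⟨m, rfl⟩ := (hιπ g).1 (hN.eval_injective (by lia) _ fun f => by
      have h₁ := hg (dualMap π f)
      rw [LinearMap.comp_apply, hex.apply_apply_eq_zero, map_zero] at h₁
      exact h₁.symm)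
    refine ⟨m, fun f => ?_⟩
    obtain ⟨f, rfl⟩ := hdual f
    exact hg f
  · cases j with
    | zero =>
      refine extZero_one_of_forall_extends hπ' hex hdual (fun φ => ?_) (hG.extZero_dual 0 hj)
      obtain ⟨y, hy⟩ := hN.eval_surjective (by lia) φ
      obtain ⟨x, rfl⟩ := hπ y
      exact ⟨bidualEval x, LinearMap.ext fun f => (hy f).symm⟩
    | succ j =>
      exact extZero_succ_of_extZero hπ' hex hdual (hN.extZero_dual j (by lia))
        (hG.extZero_dual (j + 1) hj)

/-- The sequence obtained by dropping the first term. -/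
abbrev CoSeq.tail (S : CoSeq A) : CoSeq A where
  G i := S.G (i + 1)
  d i := S.d (i + 1)

theorem isBidualTorsionFree_of_coresolution (n : ℕ) :
    ∀ {M : Type u} [AddCommGroup M] [Module A M] (S : CoSeq A) (ι : M →ₗ[A] S.G 0),
    (∀ j, j + 1 ≤ n → IsBidualTorsionFree A (S.G j) n) → Injective ι →
    (2 ≤ n → Exact ι (S.d 0)) → (∀ j, j + 3 ≤ n → Exact (S.d j) (S.d (j + 1))) →
    (1 ≤ n → Surjective (dualMap ι)) → (2 ≤ n → Exact (dualMap (S.d 0)) (dualMap ι)) →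
    (∀ j, j + 3 ≤ n → Exact (dualMap (S.d (j + 1))) (dualMap (S.d j))) →
    IsBidualTorsionFree A M n := by
  induction n with
  | zero =>
    intros
    exact ⟨by lia, by lia, by lia⟩
  | succ n ih =>
    intro M _ _ S ι hG hι hex₀ hex hdual hdual₀ hdual'
    have hmk := (LinearMap.range ι).mkQ_surjective
    refine .of_shortExact hι (LinearMap.exact_map_mkQ_range ι) hmk
      (hdual (by lia)) (hG 0 (by lia)) ?_
    rcases Nat.eq_zero_or_pos n with rfl | hn
    · exact ⟨by lia, by lia, by lia⟩
    let ι' : (S.G 0 ⧸ LinearMap.range ι) →ₗ[A] S.G 1 :=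
      (LinearMap.range ι).liftQ (S.d 0) (hex₀ (by lia)).linearMap_ker_eq.ge
    have hι' : ι'.comp (LinearMap.range ι).mkQ = S.d 0 := Submodule.liftQ_mkQ _ _ _
    refine ih S.tail ι' (fun j hj => ?_) ?_ (fun h => ?_) (fun j hj => hex (j + 1) (by lia))
      (fun _ => ?_) (fun h => ?_) (fun j hj => hdual' (j + 1) (by lia))
    · have h := hG (j + 1) (by lia)
      exact ⟨fun h' => h.1 (by lia), fun h' => h.2 (by lia), fun i hi => h.3 i (by lia)⟩
    · exact LinearMap.ker_eq_bot.1
        (Submodule.ker_liftQ_eq_bot _ _ _ (hex₀ (by lia)).linearMap_ker_eq.le)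
    · refine fun x => (hex 0 (by lia) x).trans ⟨?_, ?_⟩
      · rintro ⟨y, rfl⟩
        exact ⟨Submodule.Quotient.mk y, rfl⟩
      · rintro ⟨y, rfl⟩
        obtain ⟨y, rfl⟩ := hmk y
        exact ⟨y, rfl⟩
    · intro f
      obtain ⟨g, hg⟩ := (hdual₀ (by lia) (dualMap (LinearMap.range ι).mkQ f)).1
        ((exact_dualMap (LinearMap.exact_map_mkQ_range ι) hmk).apply_apply_eq_zero f)
      refine ⟨g, LinearMap.ext fun y => ?_⟩
      obtain ⟨x, rfl⟩ := hmk y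
      exact LinearMap.congr_fun hg x
    · refine fun f => Iff.trans ?_ (hdual' 0 (by lia) f)
      exact (map_eq_zero_iff _ (dualMap_injective_of_surjective hmk)).symm

end Duality

/-- **Claim (b) in the proof of Theorem 2.2 (Araya–Takahashi).**
Let `Λ` be a left and right noetherian ring, `n ∈ ℕ ∪ {∞}` and `M` a finitely
generated `Λ`-module.  Suppose there is an exact sequence
`σ : 0 → M →ι G_{-1} → G_{-2} → ⋯ → G_{-n}` of finitely generated `Λ`-modules,
each `G_i` being `(0,n)`-torsionfree (i.e. `n`-torsionfree), whose dual
`σ* : G_{-n}* → ⋯ → G_{-1}* → M* → 0` is also exact.  Then `M` is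
`(0,n)`-torsionfree.  (We write `S.G j` for `G_{-(j+1)}`; exactness is imposed at
all interior nodes of `σ` and of `σ*`.) -/
theorem n_torsionfree_of_coresolution
    (A : Type u) [Ring A] [IsNoetherianRing A] [IsNoetherianRing Aᵐᵒᵖ]
    (M : Type u) [AddCommGroup M] [Module A M] [Module.Finite A M] (n : ℕ∞)
    (S : CoSeq A) (ι : M →ₗ[A] S.G 0)
    (hmod : ∀ j : ℕ, (j : ℕ∞) + 1 ≤ n →
      Module.Finite A (S.G j) ∧ IsMNTorsionFree A (S.G j) 0 n)
    (hinj : Function.Injective ι)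
    (hex0 : 2 ≤ n → Function.Exact ι (S.d 0))
    (hex : ∀ j : ℕ, (j : ℕ∞) + 3 ≤ n → Function.Exact (S.d j) (S.d (j + 1)))
    (hdual_surj : 1 ≤ n →
      Function.Surjective (fun φ : S.G 0 →ₗ[A] A => φ.comp ι))
    (hdual0 : 2 ≤ n → Function.Exact
      (fun φ : S.G 1 →ₗ[A] A => φ.comp (S.d 0))
      (fun φ : S.G 0 →ₗ[A] A => φ.comp ι))
    (hdual : ∀ j : ℕ, (j : ℕ∞) + 3 ≤ n → Function.Exact
      (fun φ : S.G (j + 2) →ₗ[A] A => φ.comp (S.d (j + 1)))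
      (fun φ : S.G (j + 1) →ₗ[A] A => φ.comp (S.d j))) :
    IsMNTorsionFree A M 0 n := by
  refine ⟨fun j hj => absurd hj (by simp), fun F j hj F' => ?_⟩
  rw [F'.exact_comp_iff_extZero]
  have hle : ∀ {a : ℕ}, a ≤ j + 1 → (a : ℕ∞) ≤ n := fun ha =>
    le_trans (by exact_mod_cast ha) hj
  refine (F.isBidualTorsionFree_iff (j + 1)).1
    (isBidualTorsionFree_of_coresolution (j + 1) S ι (fun i hi => ?_) hinj
      (fun h => hex0 (hle h)) (fun i hi => hex i (hle hi)) (fun h => hdual_surj (hle h))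
      (fun h => hdual0 (hle h)) (fun i hi => hdual i (hle hi))) j le_rfl
  obtain ⟨_, hG⟩ := hmod i (hle hi)
  obtain ⟨F₁⟩ := nonempty_freeResolution_s3 (R := A) (S.G i)
  exact (F₁.isBidualTorsionFree_iff _).2 fun k hk =>
    (extVanish_iff_extZero k).1 (hG.2 F₁ k (hle hk))
end
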